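/- arXiv:1205.3513 — 2 statements merged into one kernel-verified Lean document; each statement's English description precedes it below -/
import Mathlib

section
/- Let Ω ⊆ ℍ be a symmetric slice domain and let f : Ω → ℍ be slice regular and continuously real-differentiable on Ω. If f is injective, then its singular set is empty; that is, for every q ∈ Ω the real differential Df(q) : ℍ → ℍ is bijective. -/
open Quaternion

/-- The 2-sphere of imaginary units of `ℍ`. -/
def QSphere : Set ℍ := {q : ℍ | q ^ 2 = -1}

/-- The slice `L_I = ℝ + ℝ I` of `ℍ`, as a set. -/
def QSlice (I : ℍ) : Set ℍ := {q : ℍ | ∃ x y : ℝ, q = (x : ℍ) + y • I}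

/-- `Ω` is a symmetric slice domain. -/
def IsSymmSliceDomain (Ω : Set ℍ) : Prop :=
  IsOpen Ω ∧ IsConnected Ω ∧ (∃ x : ℝ, (x : ℍ) ∈ Ω) ∧
  (∀ I ∈ QSphere, IsConnected (Ω ∩ QSlice I)) ∧
  (∀ x y : ℝ, ∀ I ∈ QSphere, ∀ J ∈ QSphere, (x : ℍ) + y • I ∈ Ω → (x : ℍ) + y • J ∈ Ω)

/-- `f` is slice regular on `Ω`: (really) differentiable, and on each slice `ℝ + ℝ I` the
Cauchy–Riemann equation `(∂/∂x + I ∂/∂y) f = 0` holds, i.e. `Df(q) 1 + I · Df(q) I = 0`. -/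
def SliceRegularOn (f : ℍ → ℍ) (Ω : Set ℍ) : Prop :=
  (∀ q ∈ Ω, DifferentiableAt ℝ f q) ∧
  ∀ I ∈ QSphere, ∀ q ∈ Ω ∩ QSlice I, fderiv ℝ f q 1 + I * fderiv ℝ f q I = 0

open Set Filter Topology Metric

/-- Minimum modulus principle on a disc. -/
theorem le_norm_of_forall_sphere_le_norm {H : ℂ → ℂ} {U : Set ℂ}
    (hH : DifferentiableOn ℂ H U) {c : ℂ} {r m : ℝ} (hr : 0 < r) (hball : closedBall c r ⊆ U)
    (hm : 0 < m) (hs : ∀ z ∈ sphere c r, m ≤ ‖H z‖) (hne : ∀ z ∈ closedBall c r, H z ≠ 0)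
    {a : ℂ} (ha : a ∈ closedBall c r) : m ≤ ‖H a‖ := by
  have hd : DiffContOnCl ℂ (fun z => (H z)⁻¹) (ball c r) := by
    apply DifferentiableOn.diffContOnCl
    rw [closure_ball c hr.ne']
    exact (hH.mono hball).inv hne
  have key := Complex.norm_le_of_forall_mem_frontier_norm_le (C := m⁻¹) isBounded_ball hd
    (fun z hz => by
      rw [frontier_ball c hr.ne'] at hz
      rw [norm_inv]
      exact inv_anti₀ hm (hs z hz)) (z := a) (by rwa [closure_ball c hr.ne'])
  rw [norm_inv] at key
  exact (inv_le_inv₀ (norm_pos_iff.2 (hne a ha)) hm).1 key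

theorem div_le_norm_dslope {G : ℂ → ℂ} {c a : ℂ} {r m : ℝ} (hm : 0 < m)
    (ha : a ∈ ball c r) (h0 : G a = 0) {z : ℂ} (hz : z ∈ sphere c r) (hs : m ≤ ‖G z‖) :
    m / (2 * r) ≤ ‖dslope G a z‖ := by
  have hza : z ≠ a := by
    rintro rfl
    rw [h0, norm_zero] at hs
    linarith
  have hr : 0 < r := pos_of_mem_ball ha
  rw [dslope_of_ne _ hza, slope_def_field, h0, sub_zero, norm_div]
  have h1 : ‖z - a‖ ≤ 2 * r := by
    rw [← dist_eq_norm]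
    rw [mem_sphere] at hz
    rw [mem_ball] at ha
    have := dist_triangle_right z a c
    linarith
  have h2 : 0 < ‖z - a‖ := norm_pos_iff.2 (sub_ne_zero.2 hza)
  gcongr

/-- If `a` is the only zero of `G` in a disc and it is simple, then the derivative at `a` is bounded
below in terms of the size of `G` on the boundary circle. -/
theorem div_le_norm_deriv_of_simple_zero {G : ℂ → ℂ} {U : Set ℂ} (hU : IsOpen U)
    (hG : DifferentiableOn ℂ G U) {c a : ℂ} {r m : ℝ} (hball : closedBall c r ⊆ U)
    (hm : 0 < m) (hs : ∀ z ∈ sphere c r, m ≤ ‖G z‖) (ha : a ∈ ball c r) (h0 : G a = 0)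
    (h1 : deriv G a ≠ 0) (hz : ∀ z ∈ closedBall c r, G z = 0 → z = a) :
    m / (2 * r) ≤ ‖deriv G a‖ := by
  have hr : 0 < r := pos_of_mem_ball ha
  have haU : U ∈ 𝓝 a := hU.mem_nhds (hball (ball_subset_closedBall ha))
  rw [← dslope_same]
  refine le_norm_of_forall_sphere_le_norm ((Complex.differentiableOn_dslope haU).2 hG) hr hball
    (by positivity) (fun z hz => div_le_norm_dslope hm ha h0 hz (hs z hz)) (fun z hzb => ?_)
    (ball_subset_closedBall ha)
  by_cases hza : z = a
  · rwa [hza, dslope_same]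
  · rw [dslope_of_ne _ hza, slope_def_field, h0, sub_zero]
    exact div_ne_zero (fun h => hza (hz z hzb h)) (sub_ne_zero.2 hza)

/-- The analogue of `div_le_norm_deriv_of_simple_zero` for a pair of simple zeros. -/
theorem div_le_norm_deriv_div_of_simple_zeros {G : ℂ → ℂ} {U : Set ℂ} (hU : IsOpen U)
    (hG : DifferentiableOn ℂ G U) {c a b : ℂ} {r m : ℝ} (hball : closedBall c r ⊆ U)
    (hm : 0 < m) (hs : ∀ z ∈ sphere c r, m ≤ ‖G z‖) (hab : a ≠ b)
    (ha : a ∈ ball c r) (ha0 : G a = 0) (ha1 : deriv G a ≠ 0)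
    (hb : b ∈ ball c r) (hb0 : G b = 0) (hb1 : deriv G b ≠ 0)
    (hz : ∀ z ∈ closedBall c r, G z = 0 → z = a ∨ z = b) :
    m / (2 * r) / (2 * r) ≤ ‖deriv G a / (a - b)‖ := by
  have hr : 0 < r := pos_of_mem_ball ha
  have haU : U ∈ 𝓝 a := hU.mem_nhds (hball (ball_subset_closedBall ha))
  have hbU : U ∈ 𝓝 b := hU.mem_nhds (hball (ball_subset_closedBall hb))
  have hab' : a - b ≠ 0 := sub_ne_zero.2 hab
  have hd : deriv (dslope G b) a = deriv G a / (a - b) := by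
    have hGa : HasDerivAt G (deriv G a) a := (hG.differentiableAt haU).hasDerivAt
    have h1 : HasDerivAt (fun z => G z / (z - b)) (deriv G a / (a - b)) a := by
      have := hGa.div ((hasDerivAt_id a).sub_const b) hab'
      refine this.congr_deriv ?_
      simp only [id, ha0]
      field_simp
      ring
    refine (h1.congr_of_eventuallyEq ?_).deriv
    filter_upwards [isOpen_ne.mem_nhds hab] with z hzb
    rw [dslope_of_ne _ hzb, slope_def_field, hb0, sub_zero]
  rw [← hd]
  refine div_le_norm_deriv_of_simple_zero hU ((Complex.differentiableOn_dslope hbU).2 hG) hball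
    (by positivity) (fun z hz => div_le_norm_dslope hm hb hb0 hz (hs z hz)) ha ?_ ?_ ?_
  · rw [dslope_of_ne _ hab, slope_def_field, ha0, hb0]
    simp
  · rw [hd]
    exact div_ne_zero ha1 hab'
  · intro z hzc h
    by_cases hzb : z = b
    · rw [hzb, dslope_same] at h
      exact absurd h hb1
    · rw [dslope_of_ne _ hzb, slope_def_field, hb0, sub_zero, div_eq_zero_iff] at h
      rcases h with h | h
      · exact (hz z hzc h).resolve_right hzb
      · exact absurd h (sub_ne_zero.2 hzb)

theorem mem_QSphere_iff {q : ℍ} :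
    q ∈ QSphere ↔ q.re = 0 ∧ q.imI ^ 2 + q.imJ ^ 2 + q.imK ^ 2 = 1 := by
  unfold QSphere
  rw [Set.mem_ofPred_eq, Quaternion.ext_iff]
  simp only [sq, Quaternion.re_mul, Quaternion.imI_mul, Quaternion.imJ_mul, Quaternion.imK_mul,
    Quaternion.re_neg, Quaternion.imI_neg, Quaternion.imJ_neg, Quaternion.imK_neg,
    Quaternion.re_one, Quaternion.imI_one, Quaternion.imJ_one, Quaternion.imK_one]
  constructor
  · rintro ⟨h1, h2, h3, h4⟩
    have h0 : q.re = 0 := by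
      by_contra h
      have e2 : q.imI = 0 := by
        have : q.re * q.imI = 0 := by linarith
        simpa [h] using this
      have e3 : q.imJ = 0 := by
        have : q.re * q.imJ = 0 := by linarith
        simpa [h] using this
      have e4 : q.imK = 0 := by
        have : q.re * q.imK = 0 := by linarith
        simpa [h] using this
      rw [e2, e3, e4] at h1
      nlinarith [mul_self_nonneg q.re]
    refine ⟨h0, ?_⟩
    rw [h0] at h1
    linarith
  · rintro ⟨h0, h1⟩
    rw [h0]
    refine ⟨by linarith, by ring, by ring, by ring⟩

theorem exists_mem_QSphere : ∃ J : ℍ, J ∈ QSphere :=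
  ⟨⟨0, 1, 0, 0⟩, mem_QSphere_iff.2 (by simp)⟩

theorem mul_self_of_mem_QSphere {q : ℍ} (h : q ∈ QSphere) : q * q = -1 := by
  rw [← sq]; exact h

theorem neg_mem_QSphere {q : ℍ} (h : q ∈ QSphere) : -q ∈ QSphere := by
  have : q ^ 2 = -1 := h
  change (-q) ^ 2 = -1
  rwa [neg_sq]

/-- The parametrization `x + i y ↦ x + y J` of the slice `ℝ + ℝ J`. -/
noncomputable def sliceMap (J : ℍ) : ℂ →L[ℝ] ℍ :=
  Complex.reCLM.smulRight (1 : ℍ) + Complex.imCLM.smulRight J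

theorem sliceMap_apply (J : ℍ) (z : ℂ) : sliceMap J z = (z.re : ℍ) + z.im • J := by
  ext <;> simp [sliceMap]

theorem sliceMap_one (J : ℍ) : sliceMap J 1 = 1 := by
  simp [sliceMap_apply]

theorem sliceMap_I (J : ℍ) : sliceMap J Complex.I = J := by
  simp [sliceMap_apply]

/-- The element `b + i c` of the complexification `ℂ⁴` of `ℍ`. -/
noncomputable def complexify : ℍ × ℍ →L[ℝ] (Fin 4 → ℂ) :=
  LinearMap.toContinuousLinearMap
    { toFun := fun p => ![⟨p.1.re, p.2.re⟩, ⟨p.1.imI, p.2.imI⟩, ⟨p.1.imJ, p.2.imJ⟩,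
        ⟨p.1.imK, p.2.imK⟩]
      map_add' := fun p q => by
        ext k
        fin_cases k <;> apply Complex.ext <;> simp
      map_smul' := fun t p => by
        ext k
        fin_cases k <;> apply Complex.ext <;> simp }

/-- The coordinatewise real part of an element of `ℂ⁴`, as a quaternion. -/
noncomputable def rePart : (Fin 4 → ℂ) →L[ℝ] ℍ :=
  LinearMap.toContinuousLinearMap
    { toFun := fun w => ⟨(w 0).re, (w 1).re, (w 2).re, (w 3).re⟩
      map_add' := fun p q => by apply Quaternion.ext <;> rfl
      map_smul' := fun t p => by
        apply Quaternion.ext <;> exact Complex.re_ofReal_mul _ _ }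

/-- The coordinatewise imaginary part of an element of `ℂ⁴`, as a quaternion. -/
noncomputable def imPart : (Fin 4 → ℂ) →L[ℝ] ℍ :=
  LinearMap.toContinuousLinearMap
    { toFun := fun w => ⟨(w 0).im, (w 1).im, (w 2).im, (w 3).im⟩
      map_add' := fun p q => by apply Quaternion.ext <;> rfl
      map_smul' := fun t p => by
        apply Quaternion.ext <;> exact Complex.im_ofReal_mul _ _ }

/-- The map `b + i c ↦ b + J c` from `ℂ⁴` to `ℍ`. -/
noncomputable def evalUnit (J : ℍ) : (Fin 4 → ℂ) →L[ℝ] ℍ :=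
  rePart + (ContinuousLinearMap.mul ℝ ℍ J).comp imPart

theorem evalUnit_apply (J : ℍ) (w : Fin 4 → ℂ) : evalUnit J w = rePart w + J * imPart w := rfl

@[simp]
theorem re_rePart (w : Fin 4 → ℂ) : (rePart w).re = (w 0).re := rfl

@[simp]
theorem imI_rePart (w : Fin 4 → ℂ) : (rePart w).imI = (w 1).re := rfl

@[simp]
theorem imJ_rePart (w : Fin 4 → ℂ) : (rePart w).imJ = (w 2).re := rfl

@[simp]
theorem imK_rePart (w : Fin 4 → ℂ) : (rePart w).imK = (w 3).re := rfl

@[simp]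
theorem re_imPart (w : Fin 4 → ℂ) : (imPart w).re = (w 0).im := rfl

@[simp]
theorem imI_imPart (w : Fin 4 → ℂ) : (imPart w).imI = (w 1).im := rfl

@[simp]
theorem imJ_imPart (w : Fin 4 → ℂ) : (imPart w).imJ = (w 2).im := rfl

@[simp]
theorem imK_imPart (w : Fin 4 → ℂ) : (imPart w).imK = (w 3).im := rfl

theorem complexify_apply (p : ℍ × ℍ) : complexify p =
    ![⟨p.1.re, p.2.re⟩, ⟨p.1.imI, p.2.imI⟩, ⟨p.1.imJ, p.2.imJ⟩, ⟨p.1.imK, p.2.imK⟩] := rfl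

theorem rePart_complexify (p : ℍ × ℍ) : rePart (complexify p) = p.1 := by
  ext <;> simp [complexify_apply]

theorem imPart_complexify (p : ℍ × ℍ) : imPart (complexify p) = p.2 := by
  ext <;> simp [complexify_apply]

theorem I_smul_complexify (b c : ℍ) : Complex.I • complexify (b, c) = complexify (-c, b) := by
  ext k
  fin_cases k <;> apply Complex.ext <;> simp [complexify_apply]

theorem ext_parts {w w' : Fin 4 → ℂ} (h1 : rePart w = rePart w') (h2 : imPart w = imPart w') :
    w = w' := by
  rw [Quaternion.ext_iff] at h1 h2
  simp only [re_rePart, imI_rePart, imJ_rePart, imK_rePart, re_imPart, imI_imPart, imJ_imPart,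
    imK_imPart] at h1 h2
  ext k
  fin_cases k <;> apply Complex.ext <;> simp_all

theorem rePart_I_smul (w : Fin 4 → ℂ) : rePart (Complex.I • w) = -imPart w := by
  ext <;> simp

theorem imPart_I_smul (w : Fin 4 → ℂ) : imPart (Complex.I • w) = rePart w := by
  ext <;> simp

theorem evalUnit_I_smul {J : ℍ} (hJ : J ∈ QSphere) (w : Fin 4 → ℂ) :
    evalUnit J (Complex.I • w) = J * evalUnit J w := by
  rw [evalUnit_apply, evalUnit_apply, rePart_I_smul, imPart_I_smul, mul_add, ← mul_assoc,
    mul_self_of_mem_QSphere hJ]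
  noncomm_ring

theorem continuous_evalUnit : Continuous fun p : ℍ × (Fin 4 → ℂ) => evalUnit p.1 p.2 := by
  simp only [evalUnit_apply]
  fun_prop

/-- The complex bilinear form on `ℂ⁴` extending the Euclidean scalar product of `ℍ = ℝ⁴`. -/
def dotC (w w' : Fin 4 → ℂ) : ℂ := w 0 * w' 0 + w 1 * w' 1 + w 2 * w' 2 + w 3 * w' 3

theorem exists_evalUnit_eq {w : Fin 4 → ℂ} {p : ℍ}
    (h : dotC (w - complexify (p, 0)) (w - complexify (p, 0)) = 0) :
    ∃ J ∈ QSphere, evalUnit J w = p := by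
  have h1 := congrArg Complex.re h
  have h2 := congrArg Complex.im h
  set b := rePart w with hb
  set c := imPart w with hc
  set d := p - b with hd
  have hn : d.re ^ 2 + d.imI ^ 2 + d.imJ ^ 2 + d.imK ^ 2
      = c.re ^ 2 + c.imI ^ 2 + c.imJ ^ 2 + c.imK ^ 2 := by
    simp [dotC, complexify_apply] at h1
    simp [hd, hb, hc]
    linarith
  have ho : d.re * c.re + d.imI * c.imI + d.imJ * c.imJ + d.imK * c.imK = 0 := by
    simp [dotC, complexify_apply] at h2
    simp [hd, hb, hc]
    linarith
  by_cases hc0 : c = 0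
  · obtain ⟨J, hJ⟩ := exists_mem_QSphere
    refine ⟨J, hJ, ?_⟩
    rw [evalUnit_apply, ← hb, ← hc, hc0, mul_zero, add_zero]
    have hd0 : d = 0 := by
      rw [hc0] at hn
      simp at hn
      ext <;> simp <;> nlinarith [sq_nonneg d.re, sq_nonneg d.imI, sq_nonneg d.imJ, sq_nonneg d.imK]
    exact (sub_eq_zero.1 hd0).symm
  · have hpos : normSq c ≠ 0 := by rwa [Ne, Quaternion.normSq_eq_zero]
    refine ⟨d * c⁻¹, ?_, ?_⟩
    · rw [mem_QSphere_iff]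
      have hre : (d * c⁻¹).re = 0 := by
        rw [Quaternion.instInv]
        simp
        right
        linarith
      refine ⟨hre, ?_⟩
      have h3 : normSq (d * c⁻¹) = 1 := by
        rw [map_mul, map_inv₀, Quaternion.normSq_def' d, Quaternion.normSq_def' c, hn,
          ← Quaternion.normSq_def' c, mul_inv_cancel₀ hpos]
      rw [Quaternion.normSq_def', hre] at h3
      linarith
    · rw [evalUnit_apply, ← hb, ← hc, inv_mul_cancel_right₀ hc0, hd]
      abel

theorem dotC_sub_evalUnit {J : ℍ} (hJ : J ∈ QSphere) (w : Fin 4 → ℂ) :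
    dotC (w - complexify (evalUnit J w, 0)) (w - complexify (evalUnit J w, 0)) = 0 := by
  obtain ⟨h0, h1⟩ := mem_QSphere_iff.1 hJ
  apply Complex.ext <;>
    simp [dotC, complexify_apply, evalUnit_apply, h0]
  · linear_combination
      (((w 0).im ^ 2 + (w 1).im ^ 2 + (w 2).im ^ 2 + (w 3).im ^ 2)) * h1
  · ring

theorem eventually_affine_eq_zero_along_curve {u : ℍ} {α β₁ β₂ β₃ : ℂ}
    (h : ∀ᶠ J in 𝓝 u, J ∈ QSphere → α + J.imI * β₁ + J.imJ * β₂ + J.imK * β₃ = 0)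
    (hu : u.re = 0) {a b c : ℝ → ℝ} (ha : Continuous a) (hb : Continuous b) (hc : Continuous c)
    (ha0 : a 0 = u.imI) (hb0 : b 0 = u.imJ) (hc0 : c 0 = u.imK)
    (hs : ∀ t, a t ^ 2 + b t ^ 2 + c t ^ 2 = 1) :
    ∀ᶠ t in 𝓝 (0 : ℝ), α + a t * β₁ + b t * β₂ + c t * β₃ = 0 := by
  obtain ⟨e₁, h₁₀, h₁₁, h₁₂, h₁₃⟩ : ∃ e : ℍ, e.re = 0 ∧ e.imI = 1 ∧ e.imJ = 0 ∧ e.imK = 0 :=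
    ⟨⟨0, 1, 0, 0⟩, rfl, rfl, rfl, rfl⟩
  obtain ⟨e₂, h₂₀, h₂₁, h₂₂, h₂₃⟩ : ∃ e : ℍ, e.re = 0 ∧ e.imI = 0 ∧ e.imJ = 1 ∧ e.imK = 0 :=
    ⟨⟨0, 0, 1, 0⟩, rfl, rfl, rfl, rfl⟩
  obtain ⟨e₃, h₃₀, h₃₁, h₃₂, h₃₃⟩ : ∃ e : ℍ, e.re = 0 ∧ e.imI = 0 ∧ e.imJ = 0 ∧ e.imK = 1 :=
    ⟨⟨0, 0, 0, 1⟩, rfl, rfl, rfl, rfl⟩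
  set g : ℝ → ℍ := fun t => a t • e₁ + b t • e₂ + c t • e₃ with hg
  have hre : ∀ t, (g t).re = 0 := fun t => by simp [hg, h₁₀, h₂₀, h₃₀]
  have hI : ∀ t, (g t).imI = a t := fun t => by simp [hg, h₁₁, h₂₁, h₃₁]
  have hJ : ∀ t, (g t).imJ = b t := fun t => by simp [hg, h₁₂, h₂₂, h₃₂]
  have hK : ∀ t, (g t).imK = c t := fun t => by simp [hg, h₁₃, h₂₃, h₃₃]
  have hg0 : g 0 = u := by
    apply Quaternion.ext
    · rw [hre, hu]
    · rw [hI, ha0]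
    · rw [hJ, hb0]
    · rw [hK, hc0]
  have hgc : Tendsto g (𝓝 0) (𝓝 u) := by
    rw [← hg0]
    exact Continuous.tendsto (by fun_prop) 0
  filter_upwards [hgc.eventually h] with t ht
  have := ht (mem_QSphere_iff.2 ⟨hre t, by rw [hI, hJ, hK, hs]⟩)
  rwa [hI, hJ, hK] at this

theorem eq_zero_of_eventually_rotation_eq {A B : ℂ}
    (h : ∀ᶠ t in 𝓝 (0 : ℝ), ((1 - t ^ 2) / (1 + t ^ 2) : ℝ) * A + (2 * t / (1 + t ^ 2) : ℝ) * B = A) :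
    A = 0 ∧ B = 0 := by
  have h' : ∀ᶠ t in 𝓝 (0 : ℝ),
      ((1 - (-t) ^ 2) / (1 + (-t) ^ 2) : ℝ) * A + (2 * (-t) / (1 + (-t) ^ 2) : ℝ) * B = A := by
    have : Tendsto (fun t : ℝ => -t) (𝓝 0) (𝓝 0) := by
      simpa using (continuous_neg (G := ℝ)).tendsto 0
    exact this.eventually h
  obtain ⟨t, ⟨h1, h2⟩, ht⟩ :=
    (((h.and h').filter_mono (nhdsWithin_le_nhds (s := Ioi 0))).and self_mem_nhdsWithin).exists
  have ht : (0 : ℝ) < t := ht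
  have ht' : (t : ℂ) ≠ 0 := by exact_mod_cast ht.ne'
  have hp : ((1 : ℂ) + t ^ 2) ≠ 0 := by
    have : (1 + t ^ 2 : ℝ) ≠ 0 := by positivity
    exact_mod_cast this
  push_cast at h1 h2
  rw [neg_sq] at h2
  field_simp at h1 h2
  have hA : (t : ℂ) ^ 2 * A = 0 := by linear_combination (-1 / 4 : ℂ) * (h1 + h2)
  have hB : (t : ℂ) * B = 0 := by linear_combination (1 / 4 : ℂ) * (h1 - h2)
  exact ⟨(mul_eq_zero.1 hA).resolve_left (pow_ne_zero 2 ht'), (mul_eq_zero.1 hB).resolve_left ht'⟩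

theorem eq_zero_of_affine_eq_zero_on_sphere {u : ℍ} (hu : u ∈ QSphere) {α β₁ β₂ β₃ : ℂ}
    (h : ∀ᶠ J in 𝓝 u, J ∈ QSphere → α + J.imI * β₁ + J.imJ * β₂ + J.imK * β₃ = 0) :
    α = 0 ∧ β₁ = 0 ∧ β₂ = 0 ∧ β₃ = 0 := by
  obtain ⟨h0, h1⟩ := mem_QSphere_iff.1 hu
  have hα : α + u.imI * β₁ + u.imJ * β₂ + u.imK * β₃ = 0 := h.self_of_nhds hu
  have hp : ∀ t : ℝ, 1 + t ^ 2 ≠ 0 := fun t => by positivity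
  have hr : ∀ t : ℝ, ((1 - t ^ 2) / (1 + t ^ 2)) ^ 2 + (2 * t / (1 + t ^ 2)) ^ 2 = 1 := fun t => by
    have := hp t
    field_simp
    ring
  have hcc : Continuous fun t : ℝ => (1 - t ^ 2) / (1 + t ^ 2) :=
    Continuous.div (by fun_prop) (by fun_prop) hp
  have hsc : Continuous fun t : ℝ => 2 * t / (1 + t ^ 2) :=
    Continuous.div (by fun_prop) (by fun_prop) hp
  have hm : ∀ y z : ℝ, Continuous fun t : ℝ =>
      (1 - t ^ 2) / (1 + t ^ 2) * y - 2 * t / (1 + t ^ 2) * z :=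
    fun y z => (hcc.mul_const y).sub (hsc.mul_const z)
  have ha : ∀ y z : ℝ, Continuous fun t : ℝ =>
      (1 - t ^ 2) / (1 + t ^ 2) * z + 2 * t / (1 + t ^ 2) * y :=
    fun y z => (hcc.mul_const z).add (hsc.mul_const y)
  have key : ∀ {x y z : ℝ} {b c d : ℂ}, α + x * b + y * c + z * d = 0 →
      (∀ᶠ t in 𝓝 (0 : ℝ), α + x * b +
        ((1 - t ^ 2) / (1 + t ^ 2) * y - 2 * t / (1 + t ^ 2) * z : ℝ) * c +
        ((1 - t ^ 2) / (1 + t ^ 2) * z + 2 * t / (1 + t ^ 2) * y : ℝ) * d = 0) →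
      y * c + z * d = 0 ∧ y * d - z * c = 0 := by
    intro x y z b c d he hev
    apply eq_zero_of_eventually_rotation_eq
    filter_upwards [hev] with t ht
    push_cast at ht ⊢
    linear_combination ht - he
  obtain ⟨a1, b1⟩ := key hα (eventually_affine_eq_zero_along_curve h h0 continuous_const
    (hm u.imJ u.imK) (ha u.imJ u.imK) rfl
    (by simp) (by simp) (fun t => by
      linear_combination h1 + (u.imJ ^ 2 + u.imK ^ 2) * hr t))
  obtain ⟨a2, b2⟩ := key (x := u.imJ) (y := u.imK) (z := u.imI) (b := β₂) (c := β₃) (d := β₁)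
    (by linear_combination hα) <| by
      filter_upwards [eventually_affine_eq_zero_along_curve h h0
        (ha u.imK u.imI) continuous_const
        (hm u.imK u.imI) (by simp) rfl (by simp) (fun t => by
          linear_combination h1 + (u.imI ^ 2 + u.imK ^ 2) * hr t)] with t ht
      linear_combination ht
  obtain ⟨a3, b3⟩ := key (x := u.imK) (y := u.imI) (z := u.imJ) (b := β₃) (c := β₁) (d := β₂)
    (by linear_combination hα) <| by
      filter_upwards [eventually_affine_eq_zero_along_curve h h0
        (hm u.imI u.imJ) (ha u.imI u.imJ)
        continuous_const (by simp) (by simp) rfl (fun t => by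
          linear_combination h1 + (u.imI ^ 2 + u.imJ ^ 2) * hr t)] with t ht
      linear_combination ht
  have h1' : (u.imI : ℂ) ^ 2 + (u.imJ : ℂ) ^ 2 + (u.imK : ℂ) ^ 2 = 1 := by exact_mod_cast h1
  have c1 : (u.imI : ℂ) * β₁ = 0 := by linear_combination (1 / 2 : ℂ) * (a2 + a3 - a1)
  have c2 : (u.imJ : ℂ) * β₂ = 0 := by linear_combination (1 / 2 : ℂ) * (a1 + a3 - a2)
  have c3 : (u.imK : ℂ) * β₃ = 0 := by linear_combination (1 / 2 : ℂ) * (a1 + a2 - a3)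
  refine ⟨by linear_combination hα - c1 - c2 - c3, ?_, ?_, ?_⟩
  · linear_combination (-β₁) * h1' + u.imI * (c1 + c2 + c3) - u.imJ * b3 + u.imK * b2
  · linear_combination (-β₂) * h1' + u.imJ * (c1 + c2 + c3) + u.imI * b3 - u.imK * b1
  · linear_combination (-β₃) * h1' + u.imK * (c1 + c2 + c3) - u.imI * b2 + u.imJ * b1

theorem eq_zero_of_eventually_dotC_eq_zero {u : ℍ} (hu : u ∈ QSphere) {w w' : Fin 4 → ℂ}
    (hw : imPart w ≠ 0)
    (h : ∀ᶠ J in 𝓝 u, J ∈ QSphere → dotC (w - complexify (evalUnit J w, 0)) w' = 0) : w' = 0 := by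
  set c := imPart w with hc
  have hI : (Complex.I) ^ 2 = -1 := Complex.I_sq
  have hsub : ∀ J ∈ QSphere, dotC (w - complexify (evalUnit J w, 0)) w' =
      Complex.I * (c.re * w' 0 + c.imI * w' 1 + c.imJ * w' 2 + c.imK * w' 3)
      + J.imI * (c.imI * w' 0 - c.re * w' 1 + c.imK * w' 2 - c.imJ * w' 3)
      + J.imJ * (c.imJ * w' 0 - c.imK * w' 1 - c.re * w' 2 + c.imI * w' 3)
      + J.imK * (c.imK * w' 0 + c.imJ * w' 1 - c.imI * w' 2 - c.re * w' 3) := by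
    intro J hJ
    obtain ⟨h0, -⟩ := mem_QSphere_iff.1 hJ
    apply Complex.ext <;> simp [dotC, complexify_apply, evalUnit_apply, h0, hc] <;> ring
  obtain ⟨e0, e1, e2, e3⟩ := eq_zero_of_affine_eq_zero_on_sphere hu (h.mono fun J hJ hJs => by
    rw [← hsub J hJs]
    exact hJ hJs)
  have e0 := (mul_eq_zero.1 e0).resolve_left Complex.I_ne_zero
  have hn : (c.re ^ 2 + c.imI ^ 2 + c.imJ ^ 2 + c.imK ^ 2 : ℂ) ≠ 0 := by
    have : normSq c ≠ 0 := by rwa [Ne, Quaternion.normSq_eq_zero]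
    rw [Quaternion.normSq_def'] at this
    exact_mod_cast this
  ext k
  refine (mul_eq_zero.1 (?_ : (c.re ^ 2 + c.imI ^ 2 + c.imJ ^ 2 + c.imK ^ 2 : ℂ) * w' k = 0)).resolve_left hn
  fin_cases k
  · change _ * w' 0 = 0
    linear_combination c.re * e0 + c.imI * e1 + c.imJ * e2 + c.imK * e3
  · change _ * w' 1 = 0
    linear_combination c.imI * e0 - c.re * e1 - c.imK * e2 + c.imJ * e3
  · change _ * w' 2 = 0
    linear_combination c.imJ * e0 + c.imK * e1 - c.re * e2 - c.imI * e3
  · change _ * w' 3 = 0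
    linear_combination c.imK * e0 - c.imJ * e1 + c.imI * e2 - c.re * e3

theorem eq_or_eq_conj_of_sliceMap_eq {I J : ℍ} (hI : I ∈ QSphere) (hJ : J ∈ QSphere) {z w : ℂ}
    (h : sliceMap J z = sliceMap I w) : z = w ∨ z = (starRingEnd ℂ) w := by
  obtain ⟨i0, i1⟩ := mem_QSphere_iff.1 hI
  obtain ⟨j0, j1⟩ := mem_QSphere_iff.1 hJ
  rw [sliceMap_apply, sliceMap_apply, Quaternion.ext_iff] at h
  simp [i0, j0] at h
  obtain ⟨h0, h1, h2, h3⟩ := h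
  have hsq : z.im ^ 2 = w.im ^ 2 := by
    calc z.im ^ 2 = (z.im * J.imI) ^ 2 + (z.im * J.imJ) ^ 2 + (z.im * J.imK) ^ 2 := by
          linear_combination (-z.im ^ 2) * j1
      _ = w.im ^ 2 := by
          rw [h1, h2, h3]
          linear_combination (w.im ^ 2) * i1
  rcases sq_eq_sq_iff_eq_or_eq_neg.1 hsq with h | h
  · exact Or.inl (Complex.ext h0 h)
  · exact Or.inr (Complex.ext h0 (by simpa using h))

theorem hasDerivAt_dotC_self {F : ℂ → Fin 4 → ℂ} {F' v : Fin 4 → ℂ} {z : ℂ}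
    (h : HasDerivAt F F' z) :
    HasDerivAt (fun z => dotC (F z - v) (F z - v)) (2 * dotC (F z - v) F') z := by
  have hk : ∀ k, HasDerivAt (fun z => F z k - v k) (F' k) z := fun k =>
    (hasDerivAt_pi.1 h k).sub_const _
  refine (((((hk 0).mul (hk 0)).add ((hk 1).mul (hk 1))).add ((hk 2).mul (hk 2))).add
    ((hk 3).mul (hk 3))).congr_deriv ?_
  simp only [dotC, Pi.sub_apply]
  ring

theorem continuous_dotC : Continuous fun p : (Fin 4 → ℂ) × (Fin 4 → ℂ) => dotC p.1 p.2 := by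
  unfold dotC
  fun_prop

/-- Near `p₀`, the functions `z ↦ dotC (F z - p) (F z - p)` are uniformly bounded below on a circle
where the one for `p₀` has no zero. -/
theorem eventually_le_norm_dotC_on_sphere {F : ℂ → Fin 4 → ℂ} {D : Set ℂ} (hD : IsOpen D)
    (hF : DifferentiableOn ℂ F D) {c : ℂ} {r : ℝ} (hr : 0 < r) (hball : closedBall c r ⊆ D)
    {p₀ : ℍ} (hne : ∀ z ∈ sphere c r,
      dotC (F z - complexify (p₀, 0)) (F z - complexify (p₀, 0)) ≠ 0) :
    ∃ m > 0, ∀ᶠ p in 𝓝 p₀, ∀ z ∈ sphere c r,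
      m ≤ ‖dotC (F z - complexify (p, 0)) (F z - complexify (p, 0))‖ := by
  set G : ℍ → ℂ → ℂ := fun p z => dotC (F z - complexify (p, 0)) (F z - complexify (p, 0)) with hG
  have hcont : ∀ z ∈ sphere c r, ContinuousAt (fun q : ℍ × ℂ => ‖G q.1 q.2‖) (p₀, z) := by
    intro z hz
    have hFz : ContinuousAt F z :=
      (hF.differentiableAt (hD.mem_nhds (hball (sphere_subset_closedBall hz)))).continuousAt
    have h1 : ContinuousAt (fun q : ℍ × ℂ => F q.2 - complexify (q.1, 0)) (p₀, z) := by
      refine ContinuousAt.sub ?_ (by fun_prop)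
      exact ContinuousAt.comp (f := Prod.snd) (x := (p₀, z)) hFz continuousAt_snd
    exact (continuous_dotC.continuousAt.comp (h1.prodMk h1)).norm
  have hcS : ContinuousOn (fun z => ‖G p₀ z‖) (sphere c r) := fun z hz =>
    (ContinuousAt.comp (f := fun z => (p₀, z)) (x := z) (hcont z hz)
      (by fun_prop)).continuousWithinAt
  obtain ⟨z₀, hz₀, hmin⟩ := (isCompact_sphere c r).exists_isMinOn
    (NormedSpace.sphere_nonempty.2 hr.le) hcS
  have hpos : 0 < ‖G p₀ z₀‖ := norm_pos_iff.2 (hne z₀ hz₀)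
  refine ⟨‖G p₀ z₀‖ / 2, by positivity, ?_⟩
  refine (isCompact_sphere c r).eventually_forall_of_forall_eventually (P := fun p z =>
    ‖G p₀ z₀‖ / 2 ≤ ‖G p z‖) fun z hz => ?_
  have : ‖G p₀ z₀‖ / 2 < ‖G p₀ z‖ := lt_of_lt_of_le (half_lt_self hpos) (hmin hz)
  exact ((hcont z hz).eventually (lt_mem_nhds this)).mono fun q hq => le_of_lt hq

/-- `F` is the stem function of an injective slice function. -/
structure IsInjectiveStem (F : ℂ → Fin 4 → ℂ) (D : Set ℂ) : Prop where
  isOpen : IsOpen D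
  differentiableOn : DifferentiableOn ℂ F D
  sliceMap_eq : ∀ z ∈ D, ∀ w ∈ D, ∀ I ∈ QSphere, ∀ J ∈ QSphere,
    evalUnit I (F z) = evalUnit J (F w) → sliceMap I z = sliceMap J w

namespace IsInjectiveStem

variable {F : ℂ → Fin 4 → ℂ} {D : Set ℂ}

theorem eq_or_eq_conj (h : IsInjectiveStem F D) {z w : ℂ} (hz : z ∈ D) (hw : w ∈ D) {I : ℍ}
    (hI : I ∈ QSphere)
    (h0 : dotC (F z - complexify (evalUnit I (F w), 0)) (F z - complexify (evalUnit I (F w), 0)) = 0) :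
    z = w ∨ z = (starRingEnd ℂ) w := by
  obtain ⟨J, hJ, hJz⟩ := exists_evalUnit_eq h0
  exact eq_or_eq_conj_of_sliceMap_eq hI hJ (h.sliceMap_eq z hz w hw J hJ I hI hJz)

theorem imPart_ne_zero (h : IsInjectiveStem F D) {z : ℂ} (hz : z ∈ D) (him : z.im ≠ 0) :
    imPart (F z) ≠ 0 := by
  intro h0
  obtain ⟨J, hJ⟩ := exists_mem_QSphere
  have := h.sliceMap_eq z hz z hz J hJ (-J) (neg_mem_QSphere hJ) (by
    simp [evalUnit_apply, h0])
  rw [sliceMap_apply, sliceMap_apply, add_right_inj, smul_neg, eq_neg_iff_add_eq_zero, ← add_smul,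
    smul_eq_zero, add_self_eq_zero] at this
  rcases this with h1 | h1
  · exact him h1
  · rw [h1, mem_QSphere_iff] at hJ
    simp at hJ

theorem hasDerivAt (h : IsInjectiveStem F D) {z : ℂ} (hz : z ∈ D) : HasDerivAt F (deriv F z) z :=
  (h.differentiableOn.differentiableAt (h.isOpen.mem_nhds hz)).hasDerivAt

theorem continuousAt_deriv (h : IsInjectiveStem F D) {z : ℂ} (hz : z ∈ D) :
    ContinuousAt (deriv F) z :=
  ((h.differentiableOn.deriv h.isOpen).differentiableAt (h.isOpen.mem_nhds hz)).continuousAt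

theorem differentiableOn_dotC (h : IsInjectiveStem F D) (v : Fin 4 → ℂ) :
    DifferentiableOn ℂ (fun z => dotC (F z - v) (F z - v)) D := fun _ hz =>
  (hasDerivAt_dotC_self (h.hasDerivAt hz)).differentiableAt.differentiableWithinAt

theorem not_eventually_deriv_eq_zero (h : IsInjectiveStem F D) {z : ℂ} (hz : z ∈ D) :
    ¬ ∀ᶠ w in 𝓝 z, deriv F w = 0 := by
  intro h0
  obtain ⟨ε, hε, hb⟩ := Metric.mem_nhds_iff.1 (h0.and (h.isOpen.mem_nhds hz))
  have hconst : F (z + (ε / 2 : ℝ)) = F z := by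
    refine (convex_ball z ε).is_const_of_fderivWithin_eq_zero (𝕜 := ℂ)
      (h.differentiableOn.mono fun w hw => (hb hw).2) (fun w hw => ?_) ?_ (mem_ball_self hε)
    · rw [fderivWithin_of_isOpen isOpen_ball hw]
      ext1
      simpa using (hb hw).1
    · rw [mem_ball, dist_eq_norm, add_sub_cancel_left, Complex.norm_real, Real.norm_of_nonneg]
        <;> linarith
  have hz' : z + (ε / 2 : ℝ) ∈ D := by
    refine (hb ?_).2
    rw [mem_ball, dist_eq_norm, add_sub_cancel_left, Complex.norm_real, Real.norm_of_nonneg]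
      <;> linarith
  obtain ⟨J, hJ⟩ := exists_mem_QSphere
  have := h.sliceMap_eq _ hz' z hz J hJ J hJ (by rw [hconst])
  rcases eq_or_eq_conj_of_sliceMap_eq hJ hJ this with h1 | h1 <;>
  · have := congrArg Complex.re h1
    simp at this
    linarith

theorem dotC_deriv_ne_zero (h : IsInjectiveStem F D) {z : ℂ} (hz : z ∈ D) (him : z.im ≠ 0)
    {I : ℍ} (hI : I ∈ QSphere) :
    dotC (F z - complexify (evalUnit I (F z), 0)) (deriv F z) ≠ 0 := by
  intro hsing
  have hUo : IsOpen (D ∩ {w : ℂ | 0 < w.im * z.im}) :=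
    h.isOpen.inter (isOpen_lt continuous_const (by fun_prop))
  obtain ⟨r, hr, hball⟩ := Metric.nhds_basis_closedBall.mem_iff.1
    (hUo.mem_nhds ⟨hz, by simpa using mul_self_pos.2 him⟩)
  have hballD : closedBall z r ⊆ D := fun w hw => (hball hw).1
  have honly : ∀ a ∈ closedBall z r, ∀ J ∈ QSphere, ∀ w ∈ closedBall z r,
      dotC (F w - complexify (evalUnit J (F a), 0)) (F w - complexify (evalUnit J (F a), 0)) = 0 →
      w = a := by
    intro a ha J hJ w hw h0
    refine (h.eq_or_eq_conj (hballD hw) (hballD ha) hJ h0).resolve_right ?_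
    rintro rfl
    have h1 : 0 < a.im * z.im := (hball ha).2
    have h2 : 0 < ((starRingEnd ℂ) a).im * z.im := (hball hw).2
    rw [Complex.conj_im] at h2
    linarith
  obtain ⟨m, hm, hev⟩ := eventually_le_norm_dotC_on_sphere h.isOpen h.differentiableOn hr hballD
    (p₀ := evalUnit I (F z)) (fun w hw h0 => by
      have := honly z (mem_closedBall_self hr.le) I hI w (sphere_subset_closedBall hw) h0
      rw [this, mem_sphere, dist_self] at hw
      exact hr.ne hw)
  have hFc : ContinuousAt (fun q : ℂ × ℍ => F q.1) (z, I) :=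
    ContinuousAt.comp (f := Prod.fst) (x := (z, I)) (h.hasDerivAt hz).continuousAt continuousAt_fst
  have hF'c : ContinuousAt (fun q : ℂ × ℍ => deriv F q.1) (z, I) :=
    ContinuousAt.comp (f := Prod.fst) (x := (z, I)) (h.continuousAt_deriv hz) continuousAt_fst
  have hpc : ContinuousAt (fun q : ℂ × ℍ => evalUnit q.2 (F q.1)) (z, I) :=
    ContinuousAt.comp (f := fun q : ℂ × ℍ => (q.2, F q.1)) (x := (z, I))
      continuous_evalUnit.continuousAt (continuousAt_snd.prodMk hFc)
  have hsc : ContinuousAt (fun q : ℂ × ℍ => ‖2 * dotC (F q.1 - complexify (evalUnit q.2 (F q.1), 0))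
      (deriv F q.1)‖) (z, I) := by
    have h1 : ContinuousAt (fun q : ℂ × ℍ => F q.1 - complexify (evalUnit q.2 (F q.1), 0)) (z, I) :=
      hFc.sub (complexify.continuous.continuousAt.comp (hpc.prodMk continuousAt_const))
    exact (continuousAt_const.mul (continuous_dotC.continuousAt.comp (h1.prodMk hF'c))).norm
  have hs0 : ‖2 * dotC (F z - complexify (evalUnit I (F z), 0)) (deriv F z)‖ < m / (2 * r) := by
    rw [hsing, mul_zero, norm_zero]
    positivity
  have hsmall := hsc.eventually (gt_mem_nhds hs0)
  have hzero : ∀ᶠ q : ℂ × ℍ in 𝓝 (z, I), q.2 ∈ QSphere →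
      dotC (F q.1 - complexify (evalUnit q.2 (F q.1), 0)) (deriv F q.1) = 0 := by
    filter_upwards [hsmall, hpc.eventually hev,
      continuousAt_fst.eventually (ball_mem_nhds z hr)] with q hq1 hq2 hq3 hq4
    by_contra hne
    have hqD : q.1 ∈ D := hballD (ball_subset_closedBall hq3)
    have hd := (hasDerivAt_dotC_self (v := complexify (evalUnit q.2 (F q.1), 0))
      (h.hasDerivAt hqD)).deriv
    have := div_le_norm_deriv_of_simple_zero h.isOpen
      (h.differentiableOn_dotC (complexify (evalUnit q.2 (F q.1), 0))) hballD hm hq2 hq3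
      (dotC_sub_evalUnit hq4 _) (by rw [hd]; exact mul_ne_zero two_ne_zero hne)
      (honly q.1 (ball_subset_closedBall hq3) q.2 hq4)
    rw [hd] at this
    exact absurd hq1 (not_lt.2 this)
  refine h.not_eventually_deriv_eq_zero hz ?_
  rw [nhds_prod_eq] at hzero
  filter_upwards [hzero.curry, hUo.mem_nhds (hball (mem_closedBall_self hr.le))] with w hw hwU
  refine eq_zero_of_eventually_dotC_eq_zero hI (h.imPart_ne_zero hwU.1 ?_) hw
  intro h0
  have h1 : 0 < w.im * z.im := hwU.2
  rw [h0, zero_mul] at h1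
  exact lt_irrefl _ h1

theorem deriv_ne_zero_of_im_eq_zero (h : IsInjectiveStem F D) {z : ℂ} (hz : z ∈ D)
    (him : z.im = 0) (hF0 : imPart (F z) = 0) (heval : ∀ w ∈ D, ∀ J ∈ QSphere,
      evalUnit (-J) (F ((starRingEnd ℂ) w)) = evalUnit J (F w)) :
    deriv F z ≠ 0 := by
  intro hsing
  obtain ⟨r, hr, hball⟩ := Metric.nhds_basis_closedBall.mem_iff.1 (h.isOpen.mem_nhds hz)
  obtain ⟨J, hJ⟩ := exists_mem_QSphere
  have hconj : (starRingEnd ℂ) z = z := Complex.conj_eq_iff_im.2 him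
  obtain ⟨m, hm, hev⟩ := eventually_le_norm_dotC_on_sphere h.isOpen h.differentiableOn hr hball
    (p₀ := evalUnit J (F z)) (fun w hw h0 => by
      have : w = z := by
        simpa [hconj] using h.eq_or_eq_conj (hball (sphere_subset_closedBall hw)) hz hJ h0
      rw [this, mem_sphere, dist_self] at hw
      exact hr.ne hw)
  set ζ : ℝ → ℂ := fun t => z + t * Complex.I with hζ
  have hζ0 : ζ 0 = z := by simp [hζ]
  have hζd : HasDerivAt ζ Complex.I 0 := by
    have h1 : HasDerivAt (fun t : ℝ => (t : ℂ)) 1 0 := Complex.ofRealCLM.hasDerivAt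
    have h2 := (h1.mul_const Complex.I).const_add z
    rwa [one_mul] at h2
  have hζc : Tendsto ζ (𝓝 0) (𝓝 z) := by
    simpa [hζ0] using hζd.continuousAt.tendsto
  have hFζ : Tendsto (fun t => F (ζ t)) (𝓝 0) (𝓝 (F z)) :=
    (h.hasDerivAt hz).continuousAt.tendsto.comp hζc
  have hF'ζ : Tendsto (fun t => deriv F (ζ t)) (𝓝 0) (𝓝 0) := by
    rw [← hsing]
    exact (h.continuousAt_deriv hz).tendsto.comp hζc
  have hpζ : Tendsto (fun t => evalUnit J (F (ζ t))) (𝓝 0) (𝓝 (evalUnit J (F z))) :=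
    ((evalUnit J).continuous.tendsto _).comp hFζ
  have hcd : Tendsto (fun t : ℝ => t⁻¹ • imPart (F (ζ t))) (𝓝[≠] 0) (𝓝 0) := by
    have h1 : HasDerivAt (fun t => F (ζ t)) (Complex.I • deriv F z) 0 :=
      HasDerivAt.scomp (h := ζ) (x := (0 : ℝ)) (by rw [hζ0]; exact h.hasDerivAt hz) hζd
    have h2 : HasDerivAt (fun t => imPart (F (ζ t))) (imPart (Complex.I • deriv F z)) 0 :=
      imPart.hasFDerivAt.comp_hasDerivAt (0 : ℝ) h1
    rw [hasDerivAt_iff_tendsto_slope_zero, hsing, smul_zero, map_zero] at h2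
    simpa [hζ0, hF0] using h2
  have hN : Tendsto (fun t : ℝ => ‖2 * dotC (F (ζ t) - complexify (evalUnit J (F (ζ t)), 0))
      (deriv F (ζ t)) / (ζ t - (starRingEnd ℂ) (ζ t))‖) (𝓝[≠] 0) (𝓝 0) := by
    have h1 : Tendsto (fun t : ℝ => complexify (-(J * t⁻¹ • imPart (F (ζ t))),
        t⁻¹ • imPart (F (ζ t)))) (𝓝[≠] 0) (𝓝 0) := by
      have h2 : Continuous fun c : ℍ => complexify (-(J * c), c) := by fun_prop
      have h3 := (h2.tendsto 0).comp hcd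
      rwa [mul_zero, neg_zero, Prod.mk_zero_zero, map_zero] at h3
    have h4 : Tendsto (fun t : ℝ => dotC (complexify (-(J * t⁻¹ • imPart (F (ζ t))),
        t⁻¹ • imPart (F (ζ t)))) (deriv F (ζ t)) / Complex.I) (𝓝[≠] 0) (𝓝 0) := by
      have h5 := ((continuous_dotC.tendsto ((0 : Fin 4 → ℂ), (0 : Fin 4 → ℂ))).comp
        (h1.prodMk_nhds (hF'ζ.mono_left nhdsWithin_le_nhds))).div_const Complex.I
      simpa [dotC] using h5
    refine (tendsto_zero_iff_norm_tendsto_zero.1 h4).congr' ?_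
    filter_upwards [self_mem_nhdsWithin] with t ht
    have ht0 : (t : ℂ) ≠ 0 := by exact_mod_cast ht
    have e1 : ζ t - (starRingEnd ℂ) (ζ t) = 2 * (t * Complex.I) := by
      apply Complex.ext <;> simp [hζ, him]
      ring
    have e2 : complexify (-(J * t⁻¹ • imPart (F (ζ t))), t⁻¹ • imPart (F (ζ t))) =
        t⁻¹ • (F (ζ t) - complexify (evalUnit J (F (ζ t)), 0)) := by
      refine ext_parts ?_ ?_
      · rw [rePart_complexify, map_smul, map_sub, rePart_complexify, evalUnit_apply, mul_smul_comm,
          sub_add_cancel_left, smul_neg]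
      · rw [imPart_complexify, map_smul, map_sub, imPart_complexify, sub_zero]
    have e3 : ∀ v w : Fin 4 → ℂ, dotC (t⁻¹ • v) w = (t : ℂ)⁻¹ * dotC v w := by
      intro v w
      simp [dotC]
      ring
    rw [e1, e2, e3]
    congr 1
    field_simp
  have hb : ball z r ∈ 𝓝 z := ball_mem_nhds z hr
  have hmr : 0 < m / (2 * r) / (2 * r) := by positivity
  obtain ⟨t, ⟨⟨h1, h2⟩, h3⟩, ht⟩ := (((((hζc.eventually hb).and (hpζ.eventually hev)).filter_mono
    nhdsWithin_le_nhds).and (hN.eventually (gt_mem_nhds hmr))).and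
    (self_mem_nhdsWithin (s := {t : ℝ | t ≠ 0}))).exists
  have ht : t ≠ 0 := ht
  have hbD : ∀ {w}, w ∈ ball z r → w ∈ D := fun hw => hball (ball_subset_closedBall hw)
  have h1' : (starRingEnd ℂ) (ζ t) ∈ ball z r := by
    have h1 : dist (ζ t) z < r := h1
    calc dist ((starRingEnd ℂ) (ζ t)) z = dist ((starRingEnd ℂ) (ζ t)) ((starRingEnd ℂ) z) := by
          rw [hconj]
      _ = dist (ζ t) z := Complex.dist_conj_conj _ _
      _ < r := h1
  have him1 : (ζ t).im ≠ 0 := by simpa [hζ, him] using ht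
  have hne : ζ t ≠ (starRingEnd ℂ) (ζ t) := fun h0 =>
    him1 (Complex.conj_eq_iff_im.1 h0.symm)
  have hd := (hasDerivAt_dotC_self (v := complexify (evalUnit J (F (ζ t)), 0))
    (h.hasDerivAt (hbD h1))).deriv
  have hd' := (hasDerivAt_dotC_self (v := complexify (evalUnit J (F (ζ t)), 0))
    (h.hasDerivAt (hbD h1'))).deriv
  have hpe := heval _ (hbD h1) J hJ
  have key := div_le_norm_deriv_div_of_simple_zeros h.isOpen
    (h.differentiableOn_dotC (complexify (evalUnit J (F (ζ t)), 0))) hball hm h2 hne h1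
    (dotC_sub_evalUnit hJ _)
    (by rw [hd]; exact mul_ne_zero two_ne_zero (h.dotC_deriv_ne_zero (hbD h1) him1 hJ)) h1'
    (by rw [← hpe]; exact dotC_sub_evalUnit (neg_mem_QSphere hJ) _)
    (by
      rw [hd', ← hpe]
      exact mul_ne_zero two_ne_zero (h.dotC_deriv_ne_zero (hbD h1') (by simpa using him1)
        (neg_mem_QSphere hJ)))
    (fun w hw hw0 => h.eq_or_eq_conj (hball hw) (hbD h1) hJ hw0)
  rw [hd] at key
  exact absurd h3 (not_lt.2 key)

end IsInjectiveStem

theorem sliceMap_conj (J : ℍ) (z : ℂ) : sliceMap J ((starRingEnd ℂ) z) = sliceMap (-J) z := by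
  simp [sliceMap_apply]

theorem sliceMap_eq_of_im_eq_zero {J K : ℍ} {z : ℂ} (hz : z.im = 0) :
    sliceMap J z = sliceMap K z := by
  simp [sliceMap_apply, hz]

theorem differentiableAt_of_hasFDerivAt_of_apply_I {E : Type*} [NormedAddCommGroup E]
    [NormedSpace ℂ E] {g : ℂ → E} {g' : ℂ →L[ℝ] E} {z : ℂ} (h : HasFDerivAt g g' z)
    (hI : g' Complex.I = Complex.I • g' 1) : DifferentiableAt ℂ g z :=
  (h.complexOfReal_hasFDerivAt hI).differentiableAt

/-- The linear functional `q ↦ Re (q a) - i Re (J q a)`, which intertwines left multiplication by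
an imaginary unit `J` with multiplication by `i`. -/
noncomputable def sliceFunctional (J a : ℍ) : ℍ →L[ℝ] ℂ :=
  LinearMap.toContinuousLinearMap
    { toFun := fun q => ⟨(q * a).re, -(J * (q * a)).re⟩
      map_add' := fun p q => by
        apply Complex.ext
        · simp only [add_mul, Quaternion.re_add, Complex.add_re]
        · simp only [add_mul, mul_add, Quaternion.re_add, Complex.add_im]
          ring
      map_smul' := fun t p => by
        apply Complex.ext
        · simp only [smul_mul_assoc, Quaternion.re_smul, RingHom.id_apply, Complex.smul_re]
        · simp only [smul_mul_assoc, mul_smul_comm, Quaternion.re_smul, RingHom.id_apply,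
            Complex.smul_im, smul_eq_mul]
          ring }

theorem sliceFunctional_apply (J a q : ℍ) :
    sliceFunctional J a q = ⟨(q * a).re, -(J * (q * a)).re⟩ := rfl

theorem sliceFunctional_mul {J : ℍ} (hJ : J ∈ QSphere) (a q : ℍ) :
    sliceFunctional J a (J * q) = Complex.I • sliceFunctional J a q := by
  have h : J * (J * q * a) = -(q * a) := by
    rw [mul_assoc J q a, ← mul_assoc J J, mul_self_of_mem_QSphere hJ, neg_one_mul]
  rw [sliceFunctional_apply, sliceFunctional_apply, h, mul_assoc]
  apply Complex.ext <;> simp only [smul_eq_mul, Complex.mul_re, Complex.mul_im, Complex.I_re,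
    Complex.I_im, Quaternion.re_neg] <;> ring

theorem eq_zero_of_sliceFunctional_eq_zero {J q : ℍ} (h : ∀ a, sliceFunctional J a q = 0) :
    q = 0 := by
  have h1 := congrArg Complex.re (h (star q))
  rw [sliceFunctional_apply] at h1
  rw [← Quaternion.normSq_eq_zero, Quaternion.normSq_def]
  exact h1

theorem sliceFunctional_one_sliceMap {J : ℍ} (hJ : J ∈ QSphere) (z : ℂ) :
    sliceFunctional J 1 (sliceMap J z) = z := by
  have h0 := (mem_QSphere_iff.1 hJ).1
  have h1 := mul_self_of_mem_QSphere hJ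
  rw [sliceFunctional_apply, mul_one, sliceMap_apply, mul_add, mul_smul_comm, h1]
  apply Complex.ext <;> simp [h0]

/-- `F` is a stem function on `D` inducing `f` on `Ω`. -/
structure IsStemOf (F : ℂ → Fin 4 → ℂ) (D : Set ℂ) (f : ℍ → ℍ) (Ω : Set ℍ) : Prop where
  isOpen : IsOpen D
  differentiableOn : DifferentiableOn ℂ F D
  mem_iff : ∀ J ∈ QSphere, ∀ z, sliceMap J z ∈ Ω ↔ z ∈ D
  apply_sliceMap : ∀ J ∈ QSphere, ∀ z ∈ D, f (sliceMap J z) = evalUnit J (F z)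

theorem SliceRegularOn.fderiv_apply {f : ℍ → ℍ} {Ω : Set ℍ} (hf : SliceRegularOn f Ω) {J : ℍ}
    (hJ : J ∈ QSphere) {z : ℂ} (hz : sliceMap J z ∈ Ω) :
    fderiv ℝ f (sliceMap J z) J = J * fderiv ℝ f (sliceMap J z) 1 := by
  have h1 := hf.2 J hJ _ ⟨hz, z.re, z.im, sliceMap_apply J z⟩
  rw [eq_neg_of_add_eq_zero_left h1, mul_neg, ← mul_assoc, mul_self_of_mem_QSphere hJ,
    neg_one_mul, neg_neg]

theorem SliceRegularOn.hasFDerivAt_comp {f : ℍ → ℍ} {Ω : Set ℍ} (hf : SliceRegularOn f Ω) {J : ℍ}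
    {z : ℂ} (hz : sliceMap J z ∈ Ω) :
    HasFDerivAt (fun w => f (sliceMap J w))
      ((fderiv ℝ f (sliceMap J z)).comp (sliceMap J)) z :=
  (hf.1 _ hz).hasFDerivAt.comp z (sliceMap J).hasFDerivAt

theorem SliceRegularOn.exists_isStemOf {f : ℍ → ℍ} {Ω : Set ℍ} (hf : SliceRegularOn f Ω)
    (hΩ : IsSymmSliceDomain Ω) : ∃ F D, IsStemOf F D f Ω := by
  obtain ⟨hΩo, -, ⟨x₀, hx₀⟩, hconn, hsymm⟩ := hΩ
  obtain ⟨J₀, hJ₀⟩ := exists_mem_QSphere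
  have hnJ₀ := neg_mem_QSphere hJ₀
  have hJJ := mul_self_of_mem_QSphere hJ₀
  set D : Set ℂ := {z | sliceMap J₀ z ∈ Ω} with hD
  have hDo : IsOpen D := hΩo.preimage (sliceMap J₀).continuous
  have hmem : ∀ J ∈ QSphere, ∀ z, sliceMap J z ∈ Ω ↔ z ∈ D := by
    intro J hJ z
    change sliceMap J z ∈ Ω ↔ sliceMap J₀ z ∈ Ω
    rw [sliceMap_apply, sliceMap_apply]
    exact ⟨hsymm _ _ _ hJ _ hJ₀, hsymm _ _ _ hJ₀ _ hJ⟩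
  set F : ℂ → Fin 4 → ℂ := fun z => complexify
    ((2⁻¹ : ℝ) • (f (sliceMap J₀ z) + f (sliceMap (-J₀) z)),
      -((2⁻¹ : ℝ) • (J₀ * (f (sliceMap J₀ z) - f (sliceMap (-J₀) z))))) with hF
  have hFdiff : DifferentiableOn ℂ F D := by
    intro z hz
    have hz1 : sliceMap J₀ z ∈ Ω := hz
    have hz2 : sliceMap (-J₀) z ∈ Ω := (hmem _ hnJ₀ z).2 hz
    have hu := hf.hasFDerivAt_comp hz1
    have hv := hf.hasFDerivAt_comp hz2
    have huI := hf.fderiv_apply hJ₀ hz1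
    have hvI := hf.fderiv_apply hnJ₀ hz2
    have h1 := (hu.add hv).const_smul (2⁻¹ : ℝ)
    have h2 := ((((ContinuousLinearMap.mul ℝ ℍ J₀).hasFDerivAt.comp z (hu.sub hv))).const_smul
      (2⁻¹ : ℝ)).neg
    have h3 := complexify.hasFDerivAt.comp z (h1.prodMk h2)
    refine (differentiableAt_of_hasFDerivAt_of_apply_I (g := F) h3 ?_).differentiableWithinAt
    simp only [ContinuousLinearMap.comp_apply, ContinuousLinearMap.prod_apply,
      smul_apply, add_apply, neg_apply,
      sub_apply, ContinuousLinearMap.mul_apply', sliceMap_one, sliceMap_I,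
      huI, hvI, I_smul_complexify]
    congr 2
    · rw [neg_neg, mul_sub, neg_mul, sub_eq_add_neg]
    · rw [← smul_neg, ← mul_neg, neg_sub, neg_mul, neg_sub_left, mul_neg, ← mul_add, ← mul_assoc,
        hJJ, neg_one_mul, neg_neg, add_comm]
  have hDpre : IsPreconnected D := by
    have h1 := (hconn J₀ hJ₀).isPreconnected.image (sliceFunctional J₀ 1)
      (sliceFunctional J₀ 1).continuous.continuousOn
    convert h1 using 1
    ext z
    constructor
    · intro hz
      exact ⟨sliceMap J₀ z, ⟨hz, z.re, z.im, sliceMap_apply J₀ z⟩,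
        sliceFunctional_one_sliceMap hJ₀ z⟩
    · rintro ⟨_, ⟨hq, x, y, rfl⟩, rfl⟩
      have h2 : (x : ℍ) + y • J₀ = sliceMap J₀ ⟨x, y⟩ := by rw [sliceMap_apply]
      rw [h2] at hq ⊢
      rw [sliceFunctional_one_sliceMap hJ₀]
      exact hq
  have hx₀D : (x₀ : ℂ) ∈ D := by
    change sliceMap J₀ (x₀ : ℂ) ∈ Ω
    rw [sliceMap_apply]
    simpa using hx₀
  refine ⟨F, D, hDo, hFdiff, hmem, fun J hJ z hz => ?_⟩
  rw [← sub_eq_zero]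
  refine eq_zero_of_sliceFunctional_eq_zero (J := J) fun a => ?_
  have hdiff : DifferentiableOn ℂ
      (fun w => sliceFunctional J a (f (sliceMap J w) - evalUnit J (F w))) D := by
    intro w hw
    have hFw := (hFdiff.differentiableAt (hDo.mem_nhds hw)).hasDerivAt.hasFDerivAt.restrictScalars ℝ
    have h1 := (sliceFunctional J a).hasFDerivAt.comp w
      ((hf.hasFDerivAt_comp ((hmem J hJ w).2 hw)).sub ((evalUnit J).hasFDerivAt.comp w hFw))
    refine (differentiableAt_of_hasFDerivAt_of_apply_I h1 ?_).differentiableWithinAt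
    have h2 := hf.fderiv_apply hJ ((hmem J hJ w).2 hw)
    simp only [ContinuousLinearMap.comp_apply, sub_apply, sliceMap_one,
      sliceMap_I, h2, ← sliceFunctional_mul hJ]
    simp [evalUnit_I_smul hJ, mul_sub]
  refine (hdiff.analyticOnNhd hDo).eqOn_zero_of_preconnected_of_frequently_eq_zero hDpre hx₀D ?_ hz
  have hreal : ∀ w ∈ D, w.im = 0 → sliceFunctional J a (f (sliceMap J w) - evalUnit J (F w)) = 0 := by
    intro w hw hw0
    rw [evalUnit_apply]
    simp only [hF, rePart_complexify, imPart_complexify]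
    rw [sliceMap_eq_of_im_eq_zero (J := -J₀) (K := J) hw0,
      sliceMap_eq_of_im_eq_zero (J := J₀) (K := J) hw0, sub_self, mul_zero, smul_zero, neg_zero,
      mul_zero, add_zero, ← two_smul ℝ, smul_smul, inv_mul_cancel₀ two_ne_zero, one_smul, sub_self,
      map_zero]
  have htend : Tendsto (fun t : ℝ => (t : ℂ)) (𝓝[≠] x₀) (𝓝[≠] (x₀ : ℂ)) := by
    refine tendsto_nhdsWithin_of_tendsto_nhds_of_eventually_within _
      (Complex.continuous_ofReal.continuousAt.tendsto.mono_left nhdsWithin_le_nhds) ?_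
    filter_upwards [self_mem_nhdsWithin] with t ht
    simpa using ht
  refine htend.frequently (Eventually.frequently ?_)
  filter_upwards [htend.eventually (nhdsWithin_le_nhds (hDo.mem_nhds hx₀D))] with t ht
  exact hreal _ ht (Complex.ofReal_im t)

theorem exists_eq_sliceMap (q : ℍ) : ∃ J ∈ QSphere, ∃ z, q = sliceMap J z := by
  have h0 : 0 ≤ q.imI ^ 2 + q.imJ ^ 2 + q.imK ^ 2 := by positivity
  set r := √(q.imI ^ 2 + q.imJ ^ 2 + q.imK ^ 2) with hr
  have hr2 : r ^ 2 = q.imI ^ 2 + q.imJ ^ 2 + q.imK ^ 2 := Real.sq_sqrt h0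
  rcases eq_or_ne r 0 with h | h
  · obtain ⟨J, hJ⟩ := exists_mem_QSphere
    refine ⟨J, hJ, (q.re : ℂ), ?_⟩
    rw [h] at hr2
    rw [sliceMap_apply]
    apply Quaternion.ext <;> simp <;>
      nlinarith [sq_nonneg q.imI, sq_nonneg q.imJ, sq_nonneg q.imK]
  · obtain ⟨J, j0, j1, j2, j3⟩ : ∃ J : ℍ, J.re = 0 ∧ J.imI = r⁻¹ * q.imI ∧ J.imJ = r⁻¹ * q.imJ ∧
        J.imK = r⁻¹ * q.imK := ⟨⟨_, _, _, _⟩, rfl, rfl, rfl, rfl⟩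
    refine ⟨J, mem_QSphere_iff.2 ⟨j0, ?_⟩, ⟨q.re, r⟩, ?_⟩
    · rw [j1, j2, j3]
      field_simp
      exact hr2.symm
    · rw [sliceMap_apply]
      apply Quaternion.ext <;> simp [j0, j1, j2, j3, h]

theorem evalUnit_smul {J : ℍ} (hJ : J ∈ QSphere) (ζ : ℂ) (w : Fin 4 → ℂ) :
    evalUnit J (ζ • w) = sliceMap J ζ * evalUnit J w := by
  have h : ζ • w = ζ.re • w + ζ.im • (Complex.I • w) := by
    ext k
    simp only [Pi.add_apply, Pi.smul_apply, smul_eq_mul, Complex.real_smul]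
    nth_rewrite 1 [← Complex.re_add_im ζ]
    ring
  rw [h, map_add, map_smul, map_smul, evalUnit_I_smul hJ, sliceMap_apply, add_mul, smul_mul_assoc,
    Quaternion.coe_mul_eq_smul]

/-- The circle through `I` in the direction of `W`, parametrized by stereographic projection. -/
theorem exists_curve_in_QSphere {I W : ℍ} (hI : I ∈ QSphere) (hW : W.re = 0)
    (hIW : I.imI * W.imI + I.imJ * W.imJ + I.imK * W.imK = 0) :
    ∃ γ : ℝ → ℍ, (∀ t, γ t ∈ QSphere) ∧ γ 0 = I ∧ HasDerivAt γ W 0 := by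
  obtain ⟨i0, i1⟩ := mem_QSphere_iff.1 hI
  set n : ℝ := (W.imI ^ 2 + W.imJ ^ 2 + W.imK ^ 2) / 4 with hn
  have hn0 : 0 ≤ n := by positivity
  have hpos : ∀ t : ℝ, 1 + n * t ^ 2 ≠ 0 := fun t => by positivity
  refine ⟨fun t => ((1 - n * t ^ 2) / (1 + n * t ^ 2)) • I + (t / (1 + n * t ^ 2)) • W, ?_, ?_, ?_⟩
  · intro t
    rw [mem_QSphere_iff]
    refine ⟨by simp [i0, hW], ?_⟩
    have h1 : ((1 - n * t ^ 2) / (1 + n * t ^ 2)) ^ 2 + (t / (1 + n * t ^ 2)) ^ 2 * (4 * n) = 1 := by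
      have := hpos t
      field_simp
      ring
    have h4 : 4 * n = W.imI ^ 2 + W.imJ ^ 2 + W.imK ^ 2 := by rw [hn]; ring
    rw [h4] at h1
    simp only [Quaternion.imI_add, Quaternion.imI_smul, Quaternion.imJ_add, Quaternion.imJ_smul,
      Quaternion.imK_add, Quaternion.imK_smul, smul_eq_mul]
    set α := (1 - n * t ^ 2) / (1 + n * t ^ 2)
    set β := t / (1 + n * t ^ 2)
    linear_combination h1 + α ^ 2 * i1 + 2 * α * β * hIW
  · simp
  · have hd : HasDerivAt (fun t : ℝ => 1 + n * t ^ 2) 0 0 := by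
      simpa using (((hasDerivAt_id (0 : ℝ)).pow 2).const_mul n).const_add 1
    have hd' : HasDerivAt (fun t : ℝ => 1 - n * t ^ 2) 0 0 := by
      simpa using (((hasDerivAt_id (0 : ℝ)).pow 2).const_mul n).const_sub 1
    have h1 := (hd'.div hd (hpos 0)).smul_const I
    have h2 := ((hasDerivAt_id (0 : ℝ)).div hd (hpos 0)).smul_const W
    exact (h1.add h2).congr_deriv (by simp)

namespace IsStemOf

variable {F : ℂ → Fin 4 → ℂ} {D : Set ℂ} {f : ℍ → ℍ} {Ω : Set ℍ}

theorem isInjectiveStem (h : IsStemOf F D f Ω) (hinj : InjOn f Ω) : IsInjectiveStem F D where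
  isOpen := h.isOpen
  differentiableOn := h.differentiableOn
  sliceMap_eq z hz w hw I hI J hJ heq := by
    rw [← h.apply_sliceMap I hI z hz, ← h.apply_sliceMap J hJ w hw] at heq
    exact hinj ((h.mem_iff I hI z).2 hz) ((h.mem_iff J hJ w).2 hw) heq

theorem conj_mem (h : IsStemOf F D f Ω) {z : ℂ} (hz : z ∈ D) : (starRingEnd ℂ) z ∈ D := by
  obtain ⟨J, hJ⟩ := exists_mem_QSphere
  rw [← h.mem_iff J hJ, sliceMap_conj, h.mem_iff _ (neg_mem_QSphere hJ)]
  exact hz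

theorem evalUnit_neg_conj (h : IsStemOf F D f Ω) {z : ℂ} (hz : z ∈ D) {J : ℍ} (hJ : J ∈ QSphere) :
    evalUnit (-J) (F ((starRingEnd ℂ) z)) = evalUnit J (F z) := by
  rw [← h.apply_sliceMap _ (neg_mem_QSphere hJ) _ (h.conj_mem hz), sliceMap_conj, neg_neg,
    h.apply_sliceMap J hJ z hz]

theorem imPart_eq_zero (h : IsStemOf F D f Ω) {z : ℂ} (hz : z ∈ D) (him : z.im = 0) :
    imPart (F z) = 0 := by
  obtain ⟨J, hJ⟩ := exists_mem_QSphere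
  have h1 := h.evalUnit_neg_conj hz hJ
  rw [Complex.conj_eq_iff_im.2 him, evalUnit_apply, evalUnit_apply, add_right_inj, neg_mul,
    neg_eq_iff_add_eq_zero, ← two_smul ℝ, ← mul_smul_comm] at h1
  have hJ0 : J ≠ 0 := by
    rintro rfl
    simpa using (mem_QSphere_iff.1 hJ).2
  simpa [hJ0] using h1

theorem hasDerivAt (h : IsStemOf F D f Ω) {z : ℂ} (hz : z ∈ D) : HasDerivAt F (deriv F z) z :=
  (h.differentiableOn.differentiableAt (h.isOpen.mem_nhds hz)).hasDerivAt

theorem fderiv_sliceMap (h : IsStemOf F D f Ω) {z : ℂ} (hz : z ∈ D) {J : ℍ} (hJ : J ∈ QSphere)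
    (hf : DifferentiableAt ℝ f (sliceMap J z)) (ζ : ℂ) :
    fderiv ℝ f (sliceMap J z) (sliceMap J ζ) = sliceMap J ζ * evalUnit J (deriv F z) := by
  have h1 := hf.hasFDerivAt.comp z (sliceMap J).hasFDerivAt
  have h2 := (evalUnit J).hasFDerivAt.comp z ((h.hasDerivAt hz).hasFDerivAt.restrictScalars ℝ)
  have h3 : f ∘ sliceMap J =ᶠ[𝓝 z] evalUnit J ∘ F := by
    filter_upwards [h.isOpen.mem_nhds hz] with w hw
    exact h.apply_sliceMap J hJ w hw
  have h4 := congrArg (fun L => L ζ) (h1.unique (h2.congr_of_eventuallyEq h3))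
  simpa [evalUnit_smul hJ] using h4

theorem smul_fderiv_of_orthogonal (h : IsStemOf F D f Ω) {z : ℂ} (hz : z ∈ D) {I W : ℍ}
    (hI : I ∈ QSphere) (hf : DifferentiableAt ℝ f (sliceMap I z)) (hW : W.re = 0)
    (hIW : I.imI * W.imI + I.imJ * W.imJ + I.imK * W.imK = 0) :
    z.im • fderiv ℝ f (sliceMap I z) W = W * imPart (F z) := by
  obtain ⟨γ, hγ, hγ0, hγd⟩ := exists_curve_in_QSphere hI hW hIW
  have h1 : HasDerivAt (fun t => sliceMap (γ t) z) (z.im • W) 0 := by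
    simp only [sliceMap_apply]
    exact (hγd.const_smul z.im).const_add _
  have h2 : HasDerivAt (fun t => f (sliceMap (γ t) z))
      (fderiv ℝ f (sliceMap I z) (z.im • W)) 0 := by
    rw [← hγ0] at hf ⊢
    exact hf.hasFDerivAt.comp_hasDerivAt (0 : ℝ) h1
  have h3 : HasDerivAt (fun t => f (sliceMap (γ t) z)) (W * imPart (F z)) 0 := by
    have h4 : (fun t => f (sliceMap (γ t) z)) = fun t => rePart (F z) + γ t * imPart (F z) := by
      ext1 t
      rw [h.apply_sliceMap _ (hγ t) z hz, evalUnit_apply]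
    rw [h4]
    exact (hγd.mul_const _).const_add _
  rw [← h2.unique h3, map_smul]

end IsStemOf

theorem dotC_eq_zero_of_orthogonal {I : ℍ} (hI : I ∈ QSphere) {w w' : Fin 4 → ℂ}
    (h1 : (evalUnit I w' * star (imPart w)).re = 0)
    (h2 : (I * (evalUnit I w' * star (imPart w))).re = 0) :
    dotC (w - complexify (evalUnit I w, 0)) w' = 0 := by
  obtain ⟨i0, i1⟩ := mem_QSphere_iff.1 hI
  have hI2 := mul_self_of_mem_QSphere hI
  rw [← mul_assoc, evalUnit_apply, mul_add, ← mul_assoc, hI2] at h2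
  rw [evalUnit_apply] at h1
  apply Complex.ext
  · simp [dotC, complexify_apply, evalUnit_apply, i0] at h2 ⊢
    linear_combination h2
  · simp [dotC, complexify_apply, evalUnit_apply, i0] at h1 ⊢
    linear_combination h1

namespace IsStemOf

variable {F : ℂ → Fin 4 → ℂ} {D : Set ℂ} {f : ℍ → ℍ} {Ω : Set ℍ}

theorem fderiv_ne_zero_of_im_eq_zero (h : IsStemOf F D f Ω) (hinj : InjOn f Ω) {z : ℂ} (hz : z ∈ D)
    (him : z.im = 0) {I : ℍ} (hf : DifferentiableAt ℝ f (sliceMap I z)) {v : ℍ} (hv : v ≠ 0) :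
    fderiv ℝ f (sliceMap I z) v ≠ 0 := by
  intro h0
  obtain ⟨J, hJ, ζ, rfl⟩ := exists_eq_sliceMap v
  have hnJ := neg_mem_QSphere hJ
  have key : ∀ K ∈ QSphere, ∀ ξ, fderiv ℝ f (sliceMap I z) (sliceMap K ξ) =
      sliceMap K ξ * evalUnit K (deriv F z) := by
    intro K hK ξ
    rw [sliceMap_eq_of_im_eq_zero (J := I) (K := K) him] at hf ⊢
    exact h.fderiv_sliceMap hz hK hf ξ
  have h1 : evalUnit J (deriv F z) = 0 := by
    rw [key J hJ] at h0
    exact (mul_eq_zero.1 h0).resolve_left hv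
  have h2 : evalUnit (-J) (deriv F z) = 0 := by
    have e1 := key J hJ 1
    have e2 := key (-J) hnJ 1
    rw [sliceMap_one, one_mul] at e1 e2
    rw [← e2, e1, h1]
  refine (h.isInjectiveStem hinj).deriv_ne_zero_of_im_eq_zero hz him (h.imPart_eq_zero hz him)
    (fun w hw K hK => h.evalUnit_neg_conj hw hK) ?_
  have hC : imPart (deriv F z) = 0 := by
    have e : (2 : ℝ) • imPart (deriv F z) = 0 := by
      rw [two_smul]
      have e3 : J * (imPart (deriv F z) + imPart (deriv F z)) = 0 := by
        rw [mul_add]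
        rw [evalUnit_apply] at h1 h2
        rw [neg_mul] at h2
        have := congrArg₂ (· - ·) h1 h2
        simp only [sub_self] at this
        rw [← this]
        abel
      refine (mul_eq_zero.1 e3).resolve_left ?_
      rintro rfl
      simpa using (mem_QSphere_iff.1 hJ).2
    simpa using e
  refine ext_parts ?_ (by rw [hC, map_zero])
  rw [evalUnit_apply, hC, mul_zero, add_zero] at h1
  rw [h1, map_zero]

theorem fderiv_ne_zero_of_im_ne_zero (h : IsStemOf F D f Ω) (hinj : InjOn f Ω) {z : ℂ} (hz : z ∈ D)
    (him : z.im ≠ 0) {I : ℍ} (hI : I ∈ QSphere) (hf : DifferentiableAt ℝ f (sliceMap I z)) {v : ℍ}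
    (hv : v ≠ 0) : fderiv ℝ f (sliceMap I z) v ≠ 0 := by
  intro h0
  obtain ⟨i0, i1⟩ := mem_QSphere_iff.1 hI
  have hC := (h.isInjectiveStem hinj).imPart_ne_zero hz him
  set C := imPart (F z) with hCdef
  set R := evalUnit I (deriv F z) with hR
  set ζ : ℂ := ⟨v.re, I.imI * v.imI + I.imJ * v.imJ + I.imK * v.imK⟩ with hζ
  set u := sliceMap I ζ with hu
  set W := v - u with hWdef
  have hvW : v = u + W := (add_sub_cancel u v).symm
  have hu0 : u.re = v.re := by simp [hu, sliceMap_apply, hζ, i0]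
  have hW0 : W.re = 0 := by rw [hWdef, Quaternion.re_sub, hu0, sub_self]
  have hIW : I.imI * W.imI + I.imJ * W.imJ + I.imK * W.imK = 0 := by
    simp [hWdef, hu, sliceMap_apply, hζ]
    linear_combination (-(I.imI * v.imI + I.imJ * v.imJ + I.imK * v.imK)) * i1
  have hDu : fderiv ℝ f (sliceMap I z) u = u * R := h.fderiv_sliceMap hz hI hf ζ
  have hDW := h.smul_fderiv_of_orthogonal hz hI hf hW0 hIW
  have hsum : z.im • (u * R) + W * C = 0 := by
    rw [← hDu, ← hDW, ← smul_add, ← map_add, ← hvW, h0, smul_zero]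
  have hu_ne : u ≠ 0 := by
    intro hu00
    rw [hu00, zero_mul, smul_zero, zero_add] at hsum
    have : W = 0 := (mul_eq_zero.1 hsum).resolve_right hC
    rw [hu00, this, add_zero] at hvW
    exact hv hvW
  have hsC : C * star C = (normSq C : ℝ) := Quaternion.self_mul_star C
  have hsu : star u * u = (normSq u : ℝ) := Quaternion.star_mul_self u
  have hK : (z.im * normSq u) • (R * star C) = -(normSq C • (star u * W)) := by
    have e : z.im • (star u * u * (R * star C)) + star u * W * (C * star C) = 0 := by
      have := congrArg (fun x => star u * x * star C) hsum
      simp only [mul_zero, zero_mul] at this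
      rw [← this]
      simp only [mul_add, add_mul, mul_smul_comm, smul_mul_assoc, mul_assoc]
    rw [hsC, hsu, Quaternion.coe_mul_eq_smul, Quaternion.mul_coe_eq_smul, smul_smul] at e
    exact eq_neg_of_add_eq_zero_left e
  have hne : z.im * normSq u ≠ 0 := mul_ne_zero him (Quaternion.normSq_ne_zero.2 hu_ne)
  have hus : star u = sliceMap I ((starRingEnd ℂ) ζ) := by
    rw [hu, sliceMap_apply, sliceMap_apply]
    apply Quaternion.ext <;> simp [i0]
  have hre : (star u * W).re = 0 := by
    rw [hus, sliceMap_apply]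
    simp [hW0, i0]
    linear_combination ζ.im * hIW
  have hre' : (I * (star u * W)).re = 0 := by
    rw [hus, sliceMap_apply, ← mul_assoc, mul_add, mul_smul_comm, mul_self_of_mem_QSphere hI]
    simp [hW0, i0]
    linear_combination (-ζ.re) * hIW
  refine (h.isInjectiveStem hinj).dotC_deriv_ne_zero hz him hI (dotC_eq_zero_of_orthogonal hI ?_ ?_)
  · have := congrArg (fun x : ℍ => x.re) hK
    simp only [Quaternion.re_smul, Quaternion.re_neg, hre, smul_eq_mul, mul_zero, neg_zero] at this
    exact (mul_eq_zero.1 this).resolve_left hne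
  · have := congrArg (fun x : ℍ => (I * x).re) hK
    simp only [mul_smul_comm, mul_neg, Quaternion.re_smul, Quaternion.re_neg, hre', smul_eq_mul,
      mul_zero, neg_zero] at this
    exact (mul_eq_zero.1 this).resolve_left hne

end IsStemOf

/-- An injective slice regular (continuously real-differentiable) function
on a symmetric slice domain has empty singular set: its real differential is everywhere
bijective. -/
theorem statement6 (Ω : Set ℍ) (hΩ : IsSymmSliceDomain Ω) (f : ℍ → ℍ)
    (hf : SliceRegularOn f Ω) (hC1 : ContDiffOn ℝ 1 f Ω) (hinj : Set.InjOn f Ω) :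
    ∀ q ∈ Ω, Function.Bijective (fderiv ℝ f q) := by
  obtain ⟨F, D, h⟩ := hf.exists_isStemOf hΩ
  intro q hq
  obtain ⟨I, hI, z, rfl⟩ := exists_eq_sliceMap q
  have hz := (h.mem_iff I hI z).1 hq
  have hinj' : Function.Injective (fderiv ℝ f (sliceMap I z)) := by
    rw [injective_iff_map_eq_zero]
    intro v hv
    by_contra hv0
    by_cases him : z.im = 0
    · exact h.fderiv_ne_zero_of_im_eq_zero hinj hz him (hf.1 _ hq) hv0 hv
    · exact h.fderiv_ne_zero_of_im_ne_zero hinj hz him hI (hf.1 _ hq) hv0 hv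
  exact ⟨hinj', LinearMap.injective_iff_surjective
    (f := (fderiv ℝ f (sliceMap I z) : ℍ →ₗ[ℝ] ℍ)).1 hinj'⟩
end

section
/- Let x₀, x₁ ∈ ℝ with x₀ > x₁², and let c = x₀ + x₁i ∈ ℍ. Then every q ∈ ℍ with q² + qi = c is of the form q = x + ti with x, t ∈ ℝ and −1 < t < 0. (Hence at such points c the two complex structures 𝕁⁺ and 𝕁⁻ induced by f(q) = q²+qi both coincide with left multiplication by −i.) -/
open Quaternion

/-- The quaternion `i`. -/
def qi : ℍ := ⟨0, 1, 0, 0⟩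

@[simp] lemma qi_re : qi.re = 0 := rfl

@[simp] lemma qi_imI : qi.imI = 1 := rfl

@[simp] lemma qi_imJ : qi.imJ = 0 := rfl

@[simp] lemma qi_imK : qi.imK = 0 := rfl

/-- If `c = x₀ + x₁ i` lies inside the parabola (`x₀ > x₁²`), then every
solution of `q² + qi = c` has the form `q = x + ti` with `x, t ∈ ℝ` and `-1 < t < 0`. -/
theorem statement13 (x₀ x₁ : ℝ) (h : x₀ > x₁ ^ 2) :
    ∀ q : ℍ, q ^ 2 + q * qi = (x₀ : ℍ) + (x₁ : ℍ) * qi →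
      ∃ x t : ℝ, -1 < t ∧ t < 0 ∧ q = (x : ℍ) + (t : ℍ) * qi := by
  intro q hq
  obtain ⟨hre, hi, hj, hk⟩ := Quaternion.ext_iff.mp hq
  simp only [pow_two, Quaternion.re_add, Quaternion.imI_add, Quaternion.imJ_add,
    Quaternion.imK_add, Quaternion.re_mul, Quaternion.imI_mul, Quaternion.imJ_mul,
    Quaternion.imK_mul, Quaternion.re_coe, Quaternion.imI_coe, Quaternion.imJ_coe,
    Quaternion.imK_coe, qi_re, qi_imI, qi_imJ, qi_imK] at hre hi hj hk
  have hc : q.imJ = 2 * q.re * q.imK := by linarith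
  have hd : q.imK = 0 := by
    have hprod : q.imK * (1 + 4 * q.re ^ 2) = 0 := by rw [hc] at hj; linarith
    exact (mul_eq_zero.mp hprod).resolve_right (by positivity)
  have hc0 : q.imJ = 0 := by rw [hc, hd, mul_zero]
  have hb : q.imI * (q.imI + 1) < 0 := by
    have hx₀ : x₀ = q.re ^ 2 - q.imI ^ 2 - q.imI := by
      rw [hd, hc0] at hre
      linarith
    have hx₁ : x₁ = 2 * q.re * q.imI + q.re := by
      rw [hd, hc0] at hi
      linarith
    have hprod : q.imI * (q.imI + 1) * (1 + 4 * q.re ^ 2) < 0 := by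
      rw [hx₀, hx₁] at h
      linarith
    exact neg_of_mul_neg_left hprod (by positivity)
  refine ⟨q.re, q.imI, by nlinarith, by nlinarith, ?_⟩
  ext <;> simp [hc0, hd]
end
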